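/- Cost to climb: there exists a universal constant γ₂ > 0 such that for every finite interval I = [a,c] ⊆ ℤ with at least four points, every function V : [a−1,c] → ℝ with V(a−1) = 0, all x, y ∈ I, every h lying between x and y, and every s ≥ 0, the chain X of the context satisfies P_ω^x[ T_y < s ] ≤ γ₂·(1+s)·π(h)/π(x). -/

import Mathlib

open MeasureTheory Set

noncomputable section

/-- The reversible measure `π(x) = e^{−V(x)} + e^{−V(x−1)}`. -/
def rpi (V : ℤ → ℝ) (x : ℤ) : ℝ := Real.exp (-V x) + Real.exp (-V (x - 1))

/-- Transition probabilities `ω_x = e^{−V(x)}/π(x)`. -/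
def rw (V : ℤ → ℝ) (x : ℤ) : ℝ := Real.exp (-V x) / rpi V x

/-- One-step transition probability of the chain on `I = [a,c]`: from `x` it
jumps to `x+1` with probability `ω_x` and to `x−1` with probability `1−ω_x`,
except that at `a` it stays put with probability `1−ω_a` and at `c` it stays
put with probability `ω_c`. -/
def rstep (a c : ℤ) (V : ℤ → ℝ) (x y : ℤ) : ℝ :=
  (if y = min (x + 1) c then rw V x else 0) +
    (if y = max (x - 1) a then 1 - rw V x else 0)

/-- `Pq x` is the law of the chain on `[a,c]` started at `x`: a probability
measure on paths whose cylinder probabilities are given by products of the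
one-step transition probabilities. -/
def IsIntervalChainLaw (a c : ℤ) (V : ℤ → ℝ) (Pq : ℤ → Measure (ℕ → ℤ)) : Prop :=
  (∀ x, IsProbabilityMeasure (Pq x)) ∧
  ∀ z ∈ Set.Icc a c, ∀ (n : ℕ) (x : ℕ → ℤ), x 0 = z →
    (Pq z {X | ∀ k ≤ n, X k = x k}).toReal
      = ∏ k ∈ Finset.range n, rstep a c V (x k) (x (k + 1))

/-- `H₊ = max_{x∈[a,c]} (max_{y∈[x,c]} V(y) − min_{y∈[a,x)} V(y))` (the terms
with `[a,x)` empty do not contribute). -/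
def Hplus (a c : ℤ) (V : ℤ → ℝ) : ℝ :=
  sSup {d : ℝ | ∃ x ∈ Set.Icc (a + 1) c,
    d = sSup (V '' Set.Icc x c) - sInf (V '' Set.Icc a (x - 1))}

/-- `H₋ = max_{x∈[a,c]} (max_{y∈[a,x]} V(y) − min_{y∈(x,c]} V(y))` (the terms
with `(x,c]` empty do not contribute). -/
def Hminus (a c : ℤ) (V : ℤ → ℝ) : ℝ :=
  sSup {d : ℝ | ∃ x ∈ Set.Icc a (c - 1),
    d = sSup (V '' Set.Icc a x) - sInf (V '' Set.Icc (x + 1) c)}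

/-- `H = H₊ ∧ H₋`. -/
def Hdep (a c : ℤ) (V : ℤ → ℝ) : ℝ := min (Hplus a c V) (Hminus a c V)

/-- `M̃ = max_{y∈[a,c]} V(y) − min_{y∈[a,c]} V(y)`. -/
def Mtilde (a c : ℤ) (V : ℤ → ℝ) : ℝ :=
  sSup (V '' Set.Icc a c) - sInf (V '' Set.Icc a c)

/-- `f = c` if `H = H₊`, and `f = a` otherwise. -/
def fpoint (a c : ℤ) (V : ℤ → ℝ) : ℤ :=
  if Hplus a c V ≤ Hminus a c V then c else a

lemma rpi_pos (V : ℤ → ℝ) (x : ℤ) : 0 < rpi V x := by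
  unfold rpi; positivity

lemma rpi_mul_rw (V : ℤ → ℝ) (x : ℤ) : rpi V x * rw V x = Real.exp (-V x) :=
  mul_div_cancel₀ _ (rpi_pos V x).ne'

lemma rpi_mul_one_sub_rw (V : ℤ → ℝ) (x : ℤ) :
    rpi V x * (1 - rw V x) = Real.exp (-V (x - 1)) := by
  have h := rpi_mul_rw V x
  have h' : rpi V x = Real.exp (-V x) + Real.exp (-V (x - 1)) := rfl
  linarith

lemma rw_nonneg (V : ℤ → ℝ) (x : ℤ) : 0 ≤ rw V x :=
  div_nonneg (Real.exp_pos _).le (rpi_pos V x).le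

lemma rw_le_one (V : ℤ → ℝ) (x : ℤ) : rw V x ≤ 1 :=
  (div_le_one (rpi_pos V x)).2 (le_add_of_nonneg_right (Real.exp_pos _).le)

lemma rstep_nonneg (a c : ℤ) (V : ℤ → ℝ) (x y : ℤ) : 0 ≤ rstep a c V x y := by
  have h₀ := rw_nonneg V x
  have h₁ := rw_le_one V x
  unfold rstep
  split_ifs <;> linarith

lemma rpi_mul_rstep (a c : ℤ) (V : ℤ → ℝ) (x y : ℤ) :
    rpi V x * rstep a c V x y =
      (if y = min (x + 1) c then Real.exp (-V x) else 0) +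
        (if y = max (x - 1) a then Real.exp (-V (x - 1)) else 0) := by
  rw [rstep, mul_add, mul_ite, mul_ite, rpi_mul_rw, rpi_mul_one_sub_rw, mul_zero]

/-- Detailed balance: the chain is reversible with respect to `π`. -/
lemma rpi_mul_rstep_comm {a c : ℤ} (V : ℤ → ℝ) {x y : ℤ}
    (hx : x ∈ Set.Icc a c) (hy : y ∈ Set.Icc a c) :
    rpi V x * rstep a c V x y = rpi V y * rstep a c V y x := by
  obtain ⟨hx₁, hx₂⟩ := hx
  obtain ⟨hy₁, hy₂⟩ := hy
  rw [rpi_mul_rstep, rpi_mul_rstep]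
  rcases lt_trichotomy x y with h | rfl | h
  · rw [if_neg (show ¬ y = max (x - 1) a by omega),
      if_neg (show ¬ x = min (y + 1) c by omega), add_zero, zero_add]
    by_cases hxy : y = x + 1
    · subst hxy
      rw [if_pos (by omega), if_pos (by omega), add_sub_cancel_right]
    · rw [if_neg (by omega), if_neg (by omega)]
  · rfl
  · rw [if_neg (show ¬ x = max (y - 1) a by omega),
      if_neg (show ¬ y = min (x + 1) c by omega), add_zero, zero_add]
    by_cases hxy : x = y + 1
    · subst hxy
      rw [if_pos (by omega), if_pos (by omega), add_sub_cancel_right]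
    · rw [if_neg (by omega), if_neg (by omega)]

lemma sum_rstep_le_one (a c : ℤ) (V : ℤ → ℝ) (x : ℤ) (s : Finset ℤ) :
    ∑ y ∈ s, rstep a c V x y ≤ 1 := by
  have h₀ := rw_nonneg V x
  have h₁ := rw_le_one V x
  simp only [rstep, Finset.sum_add_distrib, Finset.sum_ite_eq']
  split_ifs <;> linarith

lemma sum_rpi_mul_rstep_le {a c : ℤ} (V : ℤ → ℝ) {y : ℤ} (hy : y ∈ Set.Icc a c) :
    ∑ x ∈ Finset.Icc a c, rpi V x * rstep a c V x y ≤ rpi V y := by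
  calc ∑ x ∈ Finset.Icc a c, rpi V x * rstep a c V x y
      = rpi V y * ∑ x ∈ Finset.Icc a c, rstep a c V y x := by
        rw [Finset.mul_sum]
        exact Finset.sum_congr rfl fun x hx =>
          rpi_mul_rstep_comm V (Finset.mem_Icc.1 hx) hy
    _ ≤ rpi V y := mul_le_of_le_one_right (rpi_pos V y).le (sum_rstep_le_one a c V y _)

/-- A step of positive probability from `[a,c]` stays in `[a,c]` and moves by at most one. -/
lemma rstep_eq_zero {a c : ℤ} (V : ℤ → ℝ) {x y : ℤ} (hx : x ∈ Set.Icc a c)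
    (hy : ¬ (y ∈ Set.Icc a c ∧ y ≤ x + 1 ∧ x ≤ y + 1)) : rstep a c V x y = 0 := by
  obtain ⟨hx₁, hx₂⟩ := hx
  rw [Set.mem_Icc] at hy
  rw [rstep, if_neg (by omega), if_neg (by omega), add_zero]

/-- A sequence of integers with increments in `{-1, 0, 1}` going from below `h` to above `h`
visits `h`. -/
lemma exists_le_eq_of_le_add_one {X : ℕ → ℤ} {h : ℤ} {n : ℕ}
    (hstep : ∀ k, X (k + 1) ≤ X k + 1) (h₀ : X 0 ≤ h) (hn : h ≤ X n) :
    ∃ k ≤ n, X k = h := by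
  induction n with
  | zero => exact ⟨0, le_rfl, le_antisymm h₀ hn⟩
  | succ n ih =>
    by_cases hlt : h ≤ X n
    · obtain ⟨k, hk, rfl⟩ := ih hlt
      exact ⟨k, by omega, rfl⟩
    · have := hstep n
      exact ⟨n + 1, le_rfl, by omega⟩

namespace IsIntervalChainLaw

variable {a c : ℤ} {V : ℤ → ℝ} {Pq : ℤ → Measure (ℕ → ℤ)}

lemma ae_start (hP : IsIntervalChainLaw a c V Pq) {x : ℤ} (hx : x ∈ Set.Icc a c) :
    ∀ᵐ X ∂Pq x, X 0 = x := by
  have := hP.1 x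
  have h := hP.2 x hx 0 (fun _ => x) rfl
  simp only [Nat.le_zero, forall_eq, Finset.range_zero, Finset.prod_empty] at h
  have hm : MeasurableSet {X : ℕ → ℤ | X 0 = x} :=
    (measurable_pi_apply (X := fun _ : ℕ => ℤ) 0) (measurableSet_singleton x)
  exact (mem_ae_iff_prob_eq_one hm).2 ((ENNReal.toReal_eq_one_iff _).1 h)

/-- The probability of a path followed by one more step. -/
lemma measure_path_inter_step (hP : IsIntervalChainLaw a c V Pq) {x : ℤ}
    (hx : x ∈ Set.Icc a c) (n : ℕ) (p : ℕ → ℤ) (z : ℤ) :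
    Pq x ({X | ∀ k ≤ n, X k = p k} ∩ {X | X (n + 1) = z}) =
      ENNReal.ofReal (rstep a c V (p n) z) * Pq x {X | ∀ k ≤ n, X k = p k} := by
  have := hP.1 x
  by_cases hp : p 0 = x
  · let q : ℕ → ℤ := fun k => if k ≤ n then p k else z
    have hq : ∀ k ≤ n, q k = p k := fun k hk => if_pos hk
    have hqn : q (n + 1) = z := if_neg (by omega)
    have hset : {X : ℕ → ℤ | ∀ k ≤ n, X k = p k} ∩ {X | X (n + 1) = z} =
        {X | ∀ k ≤ n + 1, X k = q k} := by
      ext X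
      simp only [Set.mem_inter_iff, Set.mem_ofPred_eq, Nat.le_succ_iff_eq_or_le,
        forall_eq_or_imp, hqn]
      rw [and_comm, and_congr_right_iff]
      exact fun _ => forall₂_congr fun k hk => by rw [hq k hk]
    have h₁ := hP.2 x hx (n + 1) q (by rw [hq 0 n.zero_le, hp])
    have h₂ := hP.2 x hx n p hp
    rw [Finset.prod_range_succ, hqn, hq n le_rfl] at h₁
    rw [Finset.prod_congr rfl fun k hk => by
      rw [hq k (Finset.mem_range.1 hk).le, hq (k + 1) (Finset.mem_range.1 hk)], ← h₂] at h₁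
    rw [hset, ← ENNReal.ofReal_toReal (measure_ne_top (Pq x) {X | ∀ k ≤ n + 1, X k = q k}), h₁,
      mul_comm, ENNReal.ofReal_mul (rstep_nonneg ..), ENNReal.ofReal_toReal (measure_ne_top _ _)]
  · have h : Pq x {X | ∀ k ≤ n, X k = p k} = 0 := by
      refine measure_mono_null (fun X hX => ?_) (ae_iff.1 (hP.ae_start hx))
      exact fun h => hp ((hX 0 n.zero_le).symm.trans h)
    rw [h, mul_zero, measure_inter_null_of_null_left _ h]

/-- The Markov property at time `n`. -/
lemma measure_inter_step (hP : IsIntervalChainLaw a c V Pq) {x : ℤ}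
    (hx : x ∈ Set.Icc a c) (n : ℕ) (w z : ℤ) :
    Pq x ({X | X n = w} ∩ {X | X (n + 1) = z}) =
      ENNReal.ofReal (rstep a c V w z) * Pq x {X | X n = w} := by
  let g : (ℕ → ℤ) → (Fin (n + 1) → ℤ) := fun X i => X i
  have hg : Measurable g := measurable_pi_lambda _ fun i => measurable_pi_apply _
  suffices h : ((Pq x).restrict ({X | X n = w} ∩ {X | X (n + 1) = z})).map g =
      ENNReal.ofReal (rstep a c V w z) • ((Pq x).restrict {X | X n = w}).map g by
    have := congrArg (fun μ => μ Set.univ) h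
    simpa [Measure.map_apply hg MeasurableSet.univ] using this
  refine Measure.ext_of_singleton fun p => ?_
  let q : ℕ → ℤ := fun k => p (Fin.ofNat (n + 1) k)
  have hset : g ⁻¹' {p} = {X | ∀ k ≤ n, X k = q k} := by
    ext X
    simp only [Set.mem_preimage, Set.mem_singleton_iff, Set.mem_ofPred_eq, funext_iff, g, q,
      Fin.forall_iff, Nat.lt_succ_iff]
    refine forall₂_congr fun k hk => ?_
    have : Fin.ofNat (n + 1) k = ⟨k, Nat.lt_succ_of_le hk⟩ :=
      Fin.ext (Nat.mod_eq_of_lt (Nat.lt_succ_of_le hk))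
    rw [this]
  have hm : MeasurableSet (g ⁻¹' {p}) := hg (measurableSet_singleton p)
  rw [Measure.smul_apply, Measure.map_apply hg (measurableSet_singleton p),
    Measure.map_apply hg (measurableSet_singleton p), Measure.restrict_apply hm,
    Measure.restrict_apply hm, hset, smul_eq_mul]
  by_cases hw : q n = w
  · have hsub : {X : ℕ → ℤ | ∀ k ≤ n, X k = q k} ∩ {X | X n = w} =
        {X | ∀ k ≤ n, X k = q k} :=
      Set.inter_eq_left.2 fun X hX => (hX n le_rfl).trans hw
    rw [← Set.inter_assoc, hsub, hP.measure_path_inter_step hx, hw]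
  · have hemp : {X : ℕ → ℤ | ∀ k ≤ n, X k = q k} ∩ {X | X n = w} = ∅ :=
      Set.eq_empty_of_forall_notMem fun X hX => hw ((hX.1 n le_rfl).symm.trans hX.2)
    rw [← Set.inter_assoc, hemp, Set.empty_inter, measure_empty, mul_zero]

lemma ae_step (hP : IsIntervalChainLaw a c V Pq) {x : ℤ} (hx : x ∈ Set.Icc a c) (n : ℕ) :
    ∀ᵐ X ∂Pq x, X n ∈ Set.Icc a c →
      X (n + 1) ∈ Set.Icc a c ∧ X (n + 1) ≤ X n + 1 ∧ X n ≤ X (n + 1) + 1 := by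
  have h : ∀ w z : ℤ, ∀ᵐ X ∂Pq x, X n = w → X (n + 1) = z → w ∈ Set.Icc a c →
      z ∈ Set.Icc a c ∧ z ≤ w + 1 ∧ w ≤ z + 1 := by
    intro w z
    by_cases hwz : w ∈ Set.Icc a c → z ∈ Set.Icc a c ∧ z ≤ w + 1 ∧ w ≤ z + 1
    · exact Filter.Eventually.of_forall fun X _ _ => hwz
    · have h₀ := hP.measure_inter_step hx n w z
      rw [Classical.not_imp] at hwz
      rw [rstep_eq_zero V hwz.1 hwz.2, ENNReal.ofReal_zero, zero_mul] at h₀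
      filter_upwards [measure_eq_zero_iff_ae_notMem.1 h₀] with X hX hw hz
      exact absurd ⟨hw, hz⟩ hX
  filter_upwards [ae_all_iff.2 fun w => ae_all_iff.2 (h w)] with X hX
  exact hX _ _ rfl rfl

lemma ae_path (hP : IsIntervalChainLaw a c V Pq) {x : ℤ} (hx : x ∈ Set.Icc a c) :
    ∀ᵐ X ∂Pq x, X 0 = x ∧
      ∀ n, X n ∈ Set.Icc a c ∧ X (n + 1) ≤ X n + 1 ∧ X n ≤ X (n + 1) + 1 := by
  filter_upwards [hP.ae_start hx, ae_all_iff.2 (hP.ae_step hx)] with X h₀ hX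
  have hmem : ∀ n, X n ∈ Set.Icc a c := fun n => by
    induction n with
    | zero => rwa [h₀]
    | succ n ih => exact (hX n ih).1
  exact ⟨h₀, fun n => ⟨hmem n, (hX n (hmem n)).2⟩⟩

/-- By reversibility, `P^x[X_n = z] ≤ π(z)/π(x)`. -/
lemma measureReal_eq_le (hP : IsIntervalChainLaw a c V Pq) {x : ℤ} (hx : x ∈ Set.Icc a c)
    (n : ℕ) {z : ℤ} (hz : z ∈ Set.Icc a c) :
    (Pq x).real {X | X n = z} ≤ rpi V z / rpi V x := by
  have := hP.1 x
  induction n generalizing z with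
  | zero =>
    by_cases hzx : z = x
    · subst hzx
      rw [div_self (rpi_pos V z).ne']
      exact measureReal_le_one
    · have h : Pq x {X | X 0 = z} = 0 := by
        refine measure_mono_null (fun X hX => ?_) (ae_iff.1 (hP.ae_start hx))
        exact fun h => hzx (hX.symm.trans h)
      rw [measureReal_def, h, ENNReal.toReal_zero]
      exact (div_pos (rpi_pos V z) (rpi_pos V x)).le
  | succ n ih =>
    have hle : Pq x {X | X (n + 1) = z} ≤
        Pq x (⋃ w ∈ Finset.Icc a c, {X | X n = w} ∩ {X | X (n + 1) = z}) := by
      refine measure_mono_ae ?_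
      filter_upwards [hP.ae_path hx] with X hX hXz
      exact Set.mem_biUnion (Finset.mem_Icc.2 (hX.2 n).1) ⟨rfl, hXz⟩
    calc (Pq x).real {X | X (n + 1) = z}
        ≤ (Pq x).real (⋃ w ∈ Finset.Icc a c, {X | X n = w} ∩ {X | X (n + 1) = z}) :=
          ENNReal.toReal_mono (measure_ne_top _ _) hle
      _ ≤ ∑ w ∈ Finset.Icc a c, (Pq x).real ({X | X n = w} ∩ {X | X (n + 1) = z}) :=
          measureReal_biUnion_finset_le _ _
      _ ≤ ∑ w ∈ Finset.Icc a c, rpi V w * rstep a c V w z / rpi V x := by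
          refine Finset.sum_le_sum fun w hw => ?_
          rw [measureReal_def, hP.measure_inter_step hx, ENNReal.toReal_mul,
            ENNReal.toReal_ofReal (rstep_nonneg ..), mul_comm, mul_div_right_comm]
          exact mul_le_mul_of_nonneg_right (ih (Finset.mem_Icc.1 hw)) (rstep_nonneg ..)
      _ ≤ rpi V z / rpi V x := by
          rw [← Finset.sum_div]
          exact div_le_div_of_nonneg_right (sum_rpi_mul_rstep_le V hz) (rpi_pos V x).le

end IsIntervalChainLaw

/-- **Cost to climb.** There is a universal constant `γ₂ > 0` such that for
every interval `[a,c] ⊆ ℤ` with at least four points, every potential `V` with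
`V(a−1) = 0`, all `x, y ∈ [a,c]`, every `h` between `x` and `y` and every
`s ≥ 0`, `P_ω^x[T_y < s] ≤ γ₂ (1+s) π(h)/π(x)`. -/
theorem cost_to_climb :
    ∃ γ₂ > (0 : ℝ), ∀ a c : ℤ, a + 3 ≤ c → ∀ V : ℤ → ℝ, V (a - 1) = 0 →
      ∀ Pq : ℤ → Measure (ℕ → ℤ), IsIntervalChainLaw a c V Pq →
        ∀ x ∈ Set.Icc a c, ∀ y ∈ Set.Icc a c, ∀ h : ℤ,
          (x ≤ h ∧ h ≤ y ∨ y ≤ h ∧ h ≤ x) →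
          ∀ s : ℝ, 0 ≤ s →
            (Pq x {X | ∃ k : ℕ, (k : ℝ) < s ∧ X k = y}).toReal
              ≤ γ₂ * (1 + s) * rpi V h / rpi V x := by
  refine ⟨1, one_pos, fun a c _ V _ Pq hP x hx y hy h hh s hs => ?_⟩
  have := hP.1 x
  have hhI : h ∈ Set.Icc a c := by
    simp only [Set.mem_Icc] at *
    omega
  have hle : Pq x {X | ∃ k : ℕ, (k : ℝ) < s ∧ X k = y} ≤
      Pq x (⋃ k ∈ Finset.range ⌈s⌉₊, {X | X k = h}) := by
    refine measure_mono_ae ?_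
    filter_upwards [hP.ae_path hx] with X ⟨h₀, hX⟩ ⟨n, hn, hny⟩
    have hvisit : ∃ k ≤ n, X k = h := by
      rcases hh with ⟨hxh, hhy⟩ | ⟨hyh, hhx⟩
      · exact exists_le_eq_of_le_add_one (fun k => (hX k).2.1) (h₀.trans_le hxh)
          (hhy.trans_eq hny.symm)
      · obtain ⟨k, hk, hkh⟩ := exists_le_eq_of_le_add_one (X := fun k => -X k) (h := -h) (n := n)
          (fun k => by have := (hX k).2.2; omega) (by omega) (by omega)
        exact ⟨k, hk, neg_injective hkh⟩
    obtain ⟨k, hk, hkh⟩ := hvisit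
    exact Set.mem_biUnion (Finset.mem_range.2 (hk.trans_lt (Nat.lt_ceil.2 hn))) hkh
  calc (Pq x {X | ∃ k : ℕ, (k : ℝ) < s ∧ X k = y}).toReal
      ≤ (Pq x).real (⋃ k ∈ Finset.range ⌈s⌉₊, {X | X k = h}) :=
        ENNReal.toReal_mono (measure_ne_top _ _) hle
    _ ≤ ∑ k ∈ Finset.range ⌈s⌉₊, (Pq x).real {X | X k = h} :=
        measureReal_biUnion_finset_le _ _
    _ ≤ ∑ _k ∈ Finset.range ⌈s⌉₊, rpi V h / rpi V x :=
        Finset.sum_le_sum fun k _ => hP.measureReal_eq_le hx k hhI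
    _ = ⌈s⌉₊ * (rpi V h / rpi V x) := by
        rw [Finset.sum_const, Finset.card_range, nsmul_eq_mul]
    _ ≤ (1 + s) * (rpi V h / rpi V x) := by
        refine mul_le_mul_of_nonneg_right ?_ (div_pos (rpi_pos V h) (rpi_pos V x)).le
        linarith [Nat.ceil_lt_add_one hs]
    _ = 1 * (1 + s) * rpi V h / rpi V x := by ring
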